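/- Define, for β > 0, real n, a and τ > 0, F(β, n, a, τ) := −β( τ/8 − √τ (n + a/2) + ( n²/2 + n a/2 + a(a−1)/4 + a/(2β) ) · (1/2) log τ ). Fix β > 0, real n, a, and s > 0, and set s' := (2/β)² s (so that s'(β/2)² = s). Then the function τ ↦ F(β, n, a, τ/s) − F(4/β, β(n+1)/2 − 1, βa/2 − β + 2, τ/s') is constant on (0, ∞). -/

import Mathlib

/-- The conjectured large-`τ` expansion of `log E_β^hard(n;(0,τ))` (eq. (22a)),
with `log τ^{1/2} = (1/2) log τ`. -/
noncomputable def Fhard (β n a τ : ℝ) : ℝ :=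
  -β * (τ / 8 - Real.sqrt τ * (n + a / 2)
    + (n ^ 2 / 2 + n * a / 2 + a * (a - 1) / 4 + a / (2 * β)) * (1 / 2 * Real.log τ))

/-- Consistency of eq. (22a) with the hard-edge asymptotic duality (eq. (23x)):
with `s' = (2/β)² s` (so `s'(β/2)² = s`), the difference of the two expansions is
independent of `τ`. -/
theorem stmt15 (β n a s s' : ℝ) (hβ : 0 < β) (hs : 0 < s) (hs' : s' = (2 / β) ^ 2 * s) :
    ∃ C : ℝ, ∀ τ : ℝ, 0 < τ →
      Fhard β n a (τ / s)
        - Fhard (4 / β) (β * (n + 1) / 2 - 1) (β * a / 2 - β + 2) (τ / s') = C := by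
  refine ⟨β * (n ^ 2 / 2 + n * a / 2 + a * (a - 1) / 4 + a / (2 * β)) * Real.log (β / 2), ?_⟩
  intro τ hτ
  have hx : 0 < τ / s := div_pos hτ hs
  have h1 : τ / s' = (β / 2) ^ 2 * (τ / s) := by
    rw [hs']
    field_simp
  have hb : 0 < β / 2 := by positivity
  rw [h1]
  generalize τ / s = x at hx
  unfold Fhard
  rw [Real.sqrt_mul (by positivity), Real.sqrt_sq hb.le,
    Real.log_mul (by positivity) hx.ne', Real.log_pow]
  generalize Real.log (β / 2) = L
  generalize Real.log x = M
  generalize Real.sqrt x = r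
  push_cast
  field_simp
  ring
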